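/- (Rotation invariance) For every m ≥ 1, the extremal weight projector commutes with the rotation: d_m⁻¹ ∘ t_m ∘ d_m = t_m, equivalently d_m ∘ t_m = t_m ∘ d_m in End(V^{⊗m}). -/

import Mathlib

open Matrix

noncomputable section

/-- Sign strings `ε ∈ {+,-}^m`; `true` encodes `+` and `false` encodes `-`. -/
abbrev Sgn (m : ℕ) := Fin m → Bool

/-- Endomorphisms of `V^{⊗m}` (`V = ℂ²`), as matrices indexed by sign strings. -/
abbrev Op (m : ℕ) := Matrix (Sgn m) (Sgn m) ℂ

/-- Linear maps `V^{⊗m} → V^{⊗n}`, as matrices (rows: target, columns: source). -/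
abbrev Mor (m n : ℕ) := Matrix (Sgn n) (Sgn m) ℂ

/-- The basis vector `v_ε` of `V^{⊗m}`. -/
def bv {m : ℕ} (ε : Sgn m) : Sgn m → ℂ := fun δ => if δ = ε then 1 else 0

/-- The coefficient of `cap` on `v_a ⊗ v_b`:
`cap (v₋ ⊗ v₊) = 1`, `cap (v₊ ⊗ v₋) = -1`, `cap (v₊ ⊗ v₊) = cap (v₋ ⊗ v₋) = 0`. -/
def capc (a b : Bool) : ℂ := if a then (if b then 0 else -1) else (if b then 1 else 0)

/-- The coefficient of `v_a ⊗ v_b` in `cup 1 = v₊ ⊗ v₋ - v₋ ⊗ v₊`. -/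
def cupc (a b : Bool) : ℂ := if a then (if b then 0 else 1) else (if b then -1 else 0)

/-- The cap `V ⊗ V → ℂ`. -/
def capM : Mor 2 0 := Matrix.of fun _ ε => capc (ε 0) (ε 1)

/-- The cup `ℂ → V ⊗ V`. -/
def cupM : Mor 0 2 := Matrix.of fun δ _ => cupc (δ 0) (δ 1)

/-- The tensor product of two linear maps. -/
def tensMor {a b c d : ℕ} (A : Mor a b) (B : Mor c d) : Mor (a + c) (b + d) :=
  Matrix.of fun δ ε =>
    A (fun i => δ (Fin.castAdd d i)) (fun i => ε (Fin.castAdd c i)) *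
      B (fun j => δ (Fin.natAdd b j)) (fun j => ε (Fin.natAdd a j))

/-- The swap of the two tensor factors of `V ⊗ V`. -/
def swap2 : Op 2 := Matrix.of fun δ ε => if δ 0 = ε 1 ∧ δ 1 = ε 0 then 1 else 0

/-- `id^{⊗p} ⊗ A ⊗ id^{⊗(m-p-2)}`: the operator `A` on two strands placed at the
(0-based) positions `p`, `p+1` among `m` strands. -/
def atPos (m p : ℕ) (A : Op 2) : Op m :=
  Matrix.of fun δ ε =>
    if h : p + 2 ≤ m then
      (if ∀ k : Fin m, k.val ≠ p → k.val ≠ p + 1 → δ k = ε k then 1 else 0) *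
        A (fun i => δ ⟨p + i.val, Nat.lt_of_lt_of_le (Nat.add_lt_add_left i.isLt p) h⟩)
          (fun i => ε ⟨p + i.val, Nat.lt_of_lt_of_le (Nat.add_lt_add_left i.isLt p) h⟩)
    else 0

/-- Cyclic rotation of sign strings: `(rotIdx δ) k = δ (k+1 mod m)`. -/
def rotIdx {m : ℕ} (δ : Sgn m) : Sgn m := fun k => δ ⟨(k.val + 1) % m, Nat.mod_lt _ k.pos⟩

/-- The rotation `d_m : V^{⊗m} → V^{⊗m}`, `d_m (v_ε ⊗ w) = i^{ε} (w ⊗ v_ε)`. -/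
def dRot : (m : ℕ) → Op m
  | 0 => 1
  | (m + 1) =>
    Matrix.of fun δ' δ =>
      if δ' = rotIdx δ then (if δ 0 then Complex.I else -Complex.I) else 0

/-- The cap-cup generator `u_j` (`j` is 1-based, `1 ≤ j ≤ m-1`);
`u_0 := d_m⁻¹ ∘ u_1 ∘ d_m` is the affine generator. -/
def uFull (m j : ℕ) : Op m :=
  if j = 0 then (dRot m)⁻¹ * atPos m 0 (cupM * capM) * dRot m
  else atPos m (j - 1) (cupM * capM)

/-- The extremal weight projectors `t_m`, defined by `t₁ = id`,
`t₂ = id + u₁/2 + u₀/2`, and `t_{m+1} = (t_m ⊗ id) ∘ σ_m ∘ (t_m ⊗ id)` for `m ≥ 2`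
(with the convention `t₀ = 2·id`). -/
def tP : (m : ℕ) → Op m
  | 0 => (2 : ℂ) • 1
  | 1 => 1
  | 2 => 1 + (2⁻¹ : ℂ) • atPos 2 0 (cupM * capM) +
      (2⁻¹ : ℂ) • ((dRot 2)⁻¹ * atPos 2 0 (cupM * capM) * dRot 2)
  | (m + 3) =>
    tensMor (tP (m + 2)) (1 : Op 1) * atPos (m + 3) (m + 1) swap2 *
      tensMor (tP (m + 2)) (1 : Op 1)

/-- `n` nested caps `Ca_n : V^{⊗2n} → ℂ`. -/
def CaM (n : ℕ) : Mor (n + n) 0 :=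
  Matrix.of fun _ δ =>
    ∏ k : Fin n,
      capc (δ ⟨k.val, Nat.lt_of_lt_of_le k.isLt (Nat.le_add_right n n)⟩)
        (δ ⟨n + n - 1 - k.val,
          Nat.lt_of_le_of_lt (Nat.sub_le _ _)
            (Nat.sub_lt (Nat.lt_of_lt_of_le k.pos (Nat.le_add_right n n)) Nat.one_pos)⟩)

/-- `n` nested cups `Cu_n : ℂ → V^{⊗2n}`. -/
def CuM (n : ℕ) : Mor 0 (n + n) :=
  Matrix.of fun δ _ =>
    ∏ k : Fin n,
      cupc (δ ⟨k.val, Nat.lt_of_lt_of_le k.isLt (Nat.le_add_right n n)⟩)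
        (δ ⟨n + n - 1 - k.val,
          Nat.lt_of_le_of_lt (Nat.sub_le _ _)
            (Nat.sub_lt (Nat.lt_of_lt_of_le k.pos (Nat.le_add_right n n)) Nat.one_pos)⟩)

/-- The canonical identification of sign strings induced by an equality of lengths. -/
def sgnCast {a b : ℕ} (h : a = b) : Sgn a ≃ Sgn b :=
  Equiv.arrowCongr (finCongr h) (Equiv.refl Bool)

/-- Reindexing of a linear map along equalities of the numbers of strands. -/
def rc {a b c d : ℕ} (h1 : a = b) (h2 : c = d) (A : Mor a c) : Mor b d :=
  Matrix.reindex (sgnCast h2) (sgnCast h1) A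

/-- The idempotents `e_{m,n}`:
`e_{1,1} = -u₁/2 - d₂⁻¹ ∘ u₁ ∘ d₂ / 2` and
`e_{m,n} = -(t_m ⊗ t_n) ∘ u_m ∘ (t_m ⊗ t_n)` otherwise. -/
def eP : (m n : ℕ) → Op (m + n)
  | 1, 1 =>
    (-(2⁻¹ : ℂ)) • atPos 2 0 (cupM * capM) +
      (-(2⁻¹ : ℂ)) • ((dRot 2)⁻¹ * atPos 2 0 (cupM * capM) * dRot 2)
  | m, n =>
    -(tensMor (tP m) (tP n) * atPos (m + n) (m - 1) (cupM * capM) * tensMor (tP m) (tP n))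

theorem rotIdx_injective {m : ℕ} : Function.Injective (rotIdx (m := m)) := by
  intro δ ε h
  funext k
  have hk := congrFun h ⟨(k.val + (m - 1)) % m, Nat.mod_lt _ k.pos⟩
  have hv : ((k.val + (m - 1)) % m + 1) % m = k.val := by
    have := k.pos
    rw [Nat.mod_add_mod, show k.val + (m - 1) + 1 = k.val + m by omega, Nat.add_mod_right,
      Nat.mod_eq_of_lt k.isLt]
  simpa [rotIdx, hv] using hk

/-- The scalar `i^a` for a sign `a`. -/
def signI (a : Bool) : ℂ := if a then Complex.I else -Complex.I

theorem star_signI_mul_self (a : Bool) : star (signI a) * signI a = 1 := by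
  cases a <;> simp [signI]

theorem dRot_succ_apply {m : ℕ} (δ' δ : Sgn (m + 1)) :
    dRot (m + 1) δ' δ = if δ' = rotIdx δ then signI (δ 0) else 0 := rfl

theorem conjTranspose_dRot_mul_mul_apply {m : ℕ} (A : Op (m + 1)) (δ ε : Sgn (m + 1)) :
    ((dRot (m + 1))ᴴ * A * dRot (m + 1)) δ ε =
      star (signI (δ 0)) * A (rotIdx δ) (rotIdx ε) * signI (ε 0) := by
  simp [Matrix.mul_apply, dRot_succ_apply, apply_ite]

theorem conjTranspose_dRot_mul_dRot (m : ℕ) : (dRot (m + 1))ᴴ * dRot (m + 1) = 1 := by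
  ext δ ε
  have h := conjTranspose_dRot_mul_mul_apply 1 δ ε
  rw [mul_one] at h
  rw [h]
  rcases eq_or_ne δ ε with rfl | hne
  · simpa using star_signI_mul_self (δ 0)
  · simp [Matrix.one_apply_ne hne, Matrix.one_apply_ne (rotIdx_injective.ne hne)]

theorem inv_dRot (m : ℕ) : (dRot (m + 1))⁻¹ = (dRot (m + 1))ᴴ :=
  Matrix.inv_eq_left_inv (conjTranspose_dRot_mul_dRot m)

theorem cupM_mul_capM_apply (δ ε : Sgn 2) :
    (cupM * capM) δ ε = cupc (δ 0) (δ 1) * capc (ε 0) (ε 1) := by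
  simp [Matrix.mul_apply, cupM, capM]

theorem atPos_two_zero (A : Op 2) : atPos 2 0 A = A := by
  ext δ ε
  have h : ∀ k : Fin 2, k.val ≠ 0 → k.val ≠ 0 + 1 → δ k = ε k := by
    intro k; omega
  simp only [atPos, Matrix.of_apply, le_refl, zero_add, dite_true]
  rw [if_pos h, one_mul]

/-- The projector onto the span of the two extremal weight vectors `v_{+⋯+}` and `v_{-⋯-}`. -/
def extremalProj (m : ℕ) : Op (m + 1) :=
  Matrix.diagonal fun ε => if ∀ k, ε k = ε 0 then 1 else 0

theorem tP_two : tP 2 = extremalProj 1 := by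
  have hconst : ∀ ε : Sgn 2, (∀ k : Fin (1 + 1), ε k = ε 0) ↔ ε 1 = ε 0 := fun ε => by
    rw [Fin.forall_fin_two]
    exact and_iff_right rfl
  have hinv : (dRot 2)⁻¹ = (dRot 2)ᴴ := inv_dRot 1
  ext δ ε
  simp only [tP, hinv, atPos_two_zero, Matrix.add_apply, Matrix.smul_apply,
    conjTranspose_dRot_mul_mul_apply (m := 1), cupM_mul_capM_apply, extremalProj, Matrix.diagonal_apply,
    Matrix.one_apply, hconst, funext_iff, Fin.forall_fin_two, rotIdx]
  cases h0 : δ 0 <;> cases h1 : δ 1 <;> cases h2 : ε 0 <;> cases h3 : ε 1 <;>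
    norm_num [h0, h1, h2, h3, cupc, capc, signI]

theorem tensMor_diagonal_one {m n : ℕ} (f : Sgn m → ℂ) :
    tensMor (Matrix.diagonal f) (1 : Op n) =
      Matrix.diagonal fun ε : Sgn (m + n) => f fun i => ε (Fin.castAdd n i) := by
  ext δ ε
  rcases eq_or_ne δ ε with rfl | hne
  · simp [tensMor]
  · rw [Matrix.diagonal_apply_ne _ hne]
    simp only [tensMor, Matrix.of_apply, Matrix.diagonal_apply, Matrix.one_apply]
    split_ifs with h1 h2
    · exact absurd (funext fun k => Fin.addCases (congrFun h1) (congrFun h2) k) hne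
    all_goals simp

theorem extremalProj_recursion (m : ℕ) :
    tensMor (extremalProj (m + 1)) (1 : Op 1) * atPos (m + 3) (m + 1) swap2 *
      tensMor (extremalProj (m + 1)) (1 : Op 1) = extremalProj (m + 2) := by
  ext δ ε
  simp only [extremalProj]
  rw [tensMor_diagonal_one, Matrix.mul_diagonal, Matrix.diagonal_mul]
  have key : ∀ η : Sgn (m + 3), (∀ k, η k = η 0) ↔
      (∀ i : Fin (m + 2), η (Fin.castAdd 1 i) = η (Fin.castAdd 1 0)) ∧
        η (Fin.last (m + 2)) = η 0 := fun η => Fin.forall_fin_succ'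
  have hmid : ∀ η : Sgn (m + 3),
      (∀ i : Fin (m + 2), η (Fin.castAdd 1 i) = η (Fin.castAdd 1 0)) →
        η ⟨m + 1, by omega⟩ = η 0 := fun η h => h (Fin.last (m + 1))
  simp only [Matrix.diagonal_apply, key δ]
  by_cases hδ : ∀ i : Fin (m + 2), δ (Fin.castAdd 1 i) = δ (Fin.castAdd 1 0)
  · by_cases hε : ∀ i : Fin (m + 2), ε (Fin.castAdd 1 i) = ε (Fin.castAdd 1 0)
    · rw [if_pos hδ, if_pos hε, one_mul, mul_one]
      have hsw : atPos (m + 3) (m + 1) swap2 δ ε =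
          if (∀ k : Fin (m + 3), k.val ≠ m + 1 → k.val ≠ m + 1 + 1 → δ k = ε k) ∧
            δ ⟨m + 1, by omega⟩ = ε (Fin.last (m + 2)) ∧
            δ (Fin.last (m + 2)) = ε ⟨m + 1, by omega⟩ then 1 else 0 := by
        simp only [atPos, swap2, Matrix.of_apply, ← ite_and, ite_mul, one_mul, zero_mul]
        rw [dif_pos (by omega)]
        rfl
      rw [hsw, ← ite_and]
      refine if_congr ?_ rfl rfl
      rw [hmid δ hδ, hmid ε hε]
      constructor
      · rintro ⟨h, h1, h2⟩
        have h0 : δ 0 = ε 0 := h 0 (by simp) (by simp)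
        refine ⟨funext fun k => ?_, hδ, h2.trans h0.symm⟩
        have hδ' := (key δ).2 ⟨hδ, h2.trans h0.symm⟩ k
        have hε' := (key ε).2 ⟨hε, h1.symm.trans h0⟩ k
        rw [hδ', hε', h0]
      · rintro ⟨rfl, -, h⟩
        exact ⟨fun _ _ _ => rfl, h.symm, h⟩
    · rw [if_neg hε, mul_zero, ← ite_and, if_neg]
      rintro ⟨rfl, h, -⟩
      exact hε h
  · rw [if_neg hδ, zero_mul, zero_mul]
    rw [if_neg fun h : _ ∧ _ => hδ h.1, ite_self]

theorem tP_eq_extremalProj (m : ℕ) : tP (m + 2) = extremalProj (m + 1) := by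
  induction m with
  | zero => exact tP_two
  | succ m ih => rw [tP, ih, extremalProj_recursion]

theorem forall_rotIdx_eq_iff {m : ℕ} (ε : Sgn (m + 1)) :
    (∀ k, rotIdx ε k = rotIdx ε 0) ↔ ∀ k, ε k = ε 0 := by
  constructor
  · intro h
    have hconst : rotIdx ε = fun _ => rotIdx ε 0 := funext h
    have : ε = fun _ => rotIdx ε 0 := rotIdx_injective hconst
    intro k
    rw [congrFun this k, ← congrFun this 0]
  · intro h k
    simp only [rotIdx]
    rw [h, h ⟨((0 : Fin (m + 1)).val + 1) % (m + 1), _⟩]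

theorem dRot_mul_extremalProj (m : ℕ) :
    dRot (m + 1) * extremalProj m = extremalProj m * dRot (m + 1) := by
  ext δ ε
  rw [extremalProj, Matrix.mul_diagonal, Matrix.diagonal_mul, dRot_succ_apply]
  split_ifs with h1 h2 h3 h3 <;> simp_all [forall_rotIdx_eq_iff]

theorem dRot_mul_tP (m : ℕ) (hm : 1 ≤ m) : dRot m * tP m = tP m * dRot m := by
  match m, hm with
  | 1, _ => simp [tP]
  | m + 2, _ => rw [tP_eq_extremalProj, dRot_mul_extremalProj]

/-- Rotation invariance: `d_m⁻¹ ∘ t_m ∘ d_m = t_m`, equivalently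
`d_m ∘ t_m = t_m ∘ d_m`. -/
theorem tP_rotation_invariance (m : ℕ) (hm : 1 ≤ m) :
    (dRot m)⁻¹ * tP m * dRot m = tP m ∧ dRot m * tP m = tP m * dRot m := by
  refine ⟨?_, dRot_mul_tP m hm⟩
  obtain ⟨n, rfl⟩ : ∃ n, m = n + 1 := ⟨m - 1, by omega⟩
  rw [mul_assoc, ← dRot_mul_tP _ hm, ← mul_assoc, inv_dRot, conjTranspose_dRot_mul_dRot, one_mul]
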